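/- arXiv:2004.01784 — 3 statements merged into one kernel-verified Lean document; each statement's English description precedes it below -/
import Mathlib

section
/- Let V : ℝ × ℝ^d → ℝ be such that for every multi-index α the partial derivative ∂_x^α V exists and is continuous on ℝ × ℝ^d, and such that for every multi-index α with |α| ≥ 2 there is a constant C_α > 0 with |∂_x^α V(t,x)| ≤ C_α for all (t,x) ∈ ℝ × ℝ^d. Then there exists δ > 0 such that for all s < t with t − s ≤ δ and all x, y ∈ ℝ^d there exists a unique twice continuously differentiable curve γ : [s,t] → ℝ^d satisfying γ''(τ) = −∇_x V(τ, γ(τ)) for all τ ∈ [s,t], together with the boundary conditions γ(s) = y and γ(t) = x. -/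
open MeasureTheory Real Set Filter

noncomputable section

section BoundaryValueProblem

variable {E : Type*} [NormedAddCommGroup E] [NormedSpace ℝ E]

/-- A curve vanishing at both ends of `[s, t]` is controlled by its second derivative. -/
theorem norm_le_of_norm_deriv_deriv_le {h : ℝ → E} (hh : ContDiff ℝ 2 h) {s t M : ℝ}
    (hst : s < t) (hM : ∀ τ ∈ Icc s t, ‖deriv (deriv h) τ‖ ≤ M) (hs : h s = 0) (ht : h t = 0) :
    ∀ τ ∈ Icc s t, ‖h τ‖ ≤ 2 * M * (t - s) ^ 2 := by
  have hh' : ContDiff ℝ 1 (deriv h) := ContDiff.deriv' (by simpa [one_add_one_eq_two] using hh)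
  have hs_mem : s ∈ Icc s t := left_mem_Icc.2 hst.le
  have hM0 : 0 ≤ M := (norm_nonneg _).trans (hM s hs_mem)
  have hL : 0 < t - s := sub_pos.2 hst
  have h_velocity : ∀ σ ∈ Icc s t, ‖deriv h σ - deriv h s‖ ≤ M * (t - s) := fun σ hσ => by
    refine ((convex_Icc s t).norm_image_sub_le_of_norm_deriv_le
      (fun r _ => (hh'.differentiable one_ne_zero) r) hM hs_mem hσ).trans ?_
    rw [Real.norm_of_nonneg (sub_nonneg.2 hσ.1)]
    gcongr
    exact hσ.2
  have h_position : ∀ τ ∈ Icc s t, ‖h τ - (τ - s) • deriv h s‖ ≤ M * (t - s) ^ 2 := fun τ hτ => by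
    have hd : ∀ r ∈ Icc s t, HasDerivWithinAt (fun r => h r - (r - s) • deriv h s)
        (deriv h r - deriv h s) (Icc s t) r := fun r _ => by
      have h1 := ((hh.differentiable two_ne_zero) r).hasDerivAt
      have h2 := ((hasDerivAt_id r).sub_const s).smul_const (deriv h s)
      simpa using (h1.fun_sub h2).hasDerivWithinAt
    have := (convex_Icc s t).norm_image_sub_le_of_norm_hasDerivWithin_le hd h_velocity hs_mem hτ
    rw [Real.norm_of_nonneg (sub_nonneg.2 hτ.1)] at this
    simp only [sub_self, zero_smul, sub_zero, hs] at this
    refine this.trans ?_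
    rw [pow_two, ← mul_assoc]
    gcongr
    exact hτ.2
  intro τ hτ
  have h_end := h_position t (right_mem_Icc.2 hst.le)
  rw [ht, zero_sub, norm_neg, norm_smul, Real.norm_of_nonneg hL.le] at h_end
  have h_slope : ‖(τ - s) • deriv h s‖ ≤ M * (t - s) ^ 2 := by
    rw [norm_smul, Real.norm_of_nonneg (sub_nonneg.2 hτ.1)]
    refine le_trans ?_ h_end
    gcongr
    exact hτ.2
  have h_tri := norm_add_le (h τ - (τ - s) • deriv h s) ((τ - s) • deriv h s)
  rw [sub_add_cancel] at h_tri
  linarith [h_position τ hτ]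

/-- The two-point boundary value problem `γ'' = g` with continuous `g` is solvable. -/
theorem exists_contDiff_two_deriv_deriv_eq [CompleteSpace E] {g : ℝ → E} (hg : Continuous g)
    {s t : ℝ} (hst : s < t) (x y : E) :
    ∃ γ : ℝ → E, ContDiff ℝ 2 γ ∧ (∀ τ, deriv (deriv γ) τ = g τ) ∧ γ s = y ∧ γ t = x := by
  set G : ℝ → E := fun σ => ∫ r in s..σ, g r
  have hG : ∀ σ, HasDerivAt G (g σ) σ := fun σ => hg.integral_hasStrictDerivAt s σ |>.hasDerivAt
  have hG_cont : Continuous G := continuous_iff_continuousAt.2 fun σ => (hG σ).continuousAt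
  set H : ℝ → E := fun τ => ∫ σ in s..τ, G σ with hH_def
  have hH : ∀ τ, HasDerivAt H (G τ) τ := fun τ =>
    hG_cont.integral_hasStrictDerivAt s τ |>.hasDerivAt
  set w : E := (t - s)⁻¹ • (x - y - H t)
  have h_first : ∀ τ, HasDerivAt (fun τ => y + (τ - s) • w + H τ) (w + G τ) τ := fun τ => by
    have h2 := ((hasDerivAt_id τ).sub_const s).smul_const w
    simpa using (h2.const_add y).fun_add (hH τ)
  have h_second : ∀ τ, HasDerivAt (fun τ => w + G τ) (g τ) τ := fun τ => (hG τ).const_add w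
  have h_deriv : deriv (fun τ => y + (τ - s) • w + H τ) = fun τ => w + G τ :=
    funext fun τ => (h_first τ).deriv
  have h_deriv' : deriv (fun τ => w + G τ) = g := funext fun τ => (h_second τ).deriv
  refine ⟨fun τ => y + (τ - s) • w + H τ, ?_, ?_, ?_, ?_⟩
  · rw [show (2 : WithTop ℕ∞) = 1 + 1 by norm_num, contDiff_succ_iff_deriv]
    refine ⟨fun τ => (h_first τ).differentiableAt, by simp, ?_⟩
    rw [h_deriv, contDiff_one_iff_deriv, h_deriv']
    exact ⟨fun τ => (h_second τ).differentiableAt, hg⟩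
  · intro τ
    rw [h_deriv, h_deriv']
  · simp [hH_def]
  · have : (t - s) • w = x - y - H t := smul_inv_smul₀ (sub_pos.2 hst).ne' _
    simp only [this]
    abel

/-- If `F` is continuous and `K`-Lipschitz in space, the boundary value problem for `γ'' = F τ γ`
is uniquely solvable on every interval whose length `L` satisfies `2 * K * L ^ 2 ≤ 1 / 2`. -/
theorem exists_unique_boundary_value_problem [CompleteSpace E] {F : ℝ → E → E} {K : NNReal}
    (hF : Continuous fun p : ℝ × E => F p.1 p.2) (hK : ∀ τ, LipschitzWith K (F τ))
    {s t : ℝ} (hst : s < t) (h_short : 2 * K * (t - s) ^ 2 ≤ 1 / 2) (x y : E) :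
    ∃ γ : ℝ → E,
      (ContDiff ℝ 2 γ ∧ (∀ τ ∈ Icc s t, deriv (deriv γ) τ = F τ (γ τ)) ∧ γ s = y ∧ γ t = x) ∧
      ∀ γ' : ℝ → E,
        (ContDiff ℝ 2 γ' ∧ (∀ τ ∈ Icc s t, deriv (deriv γ') τ = F τ (γ' τ)) ∧
          γ' s = y ∧ γ' t = x) →
        ∀ τ ∈ Icc s t, γ' τ = γ τ := by
  have h_compare : ∀ {γ₁ γ₂ : ℝ → E}, ContDiff ℝ 2 γ₁ → ContDiff ℝ 2 γ₂ →
      γ₁ s = γ₂ s → γ₁ t = γ₂ t → ∀ {m : ℝ},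
      (∀ τ ∈ Icc s t, ‖deriv (deriv γ₁) τ - deriv (deriv γ₂) τ‖ ≤ K * m) →
      0 ≤ m → ∀ τ ∈ Icc s t, ‖γ₁ τ - γ₂ τ‖ ≤ 1 / 2 * m := by
    intro γ₁ γ₂ h₁ h₂ hs ht m hm hm0 τ hτ
    have h₁' : ContDiff ℝ 1 (deriv γ₁) := ContDiff.deriv' (by simpa [one_add_one_eq_two] using h₁)
    have h₂' : ContDiff ℝ 1 (deriv γ₂) := ContDiff.deriv' (by simpa [one_add_one_eq_two] using h₂)
    have hd : deriv (fun r => γ₁ r - γ₂ r) = fun r => deriv γ₁ r - deriv γ₂ r :=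
      funext fun r => deriv_fun_sub (h₁.differentiable two_ne_zero r)
        (h₂.differentiable two_ne_zero r)
    have hdd : ∀ r, deriv (deriv fun r => γ₁ r - γ₂ r) r
        = deriv (deriv γ₁) r - deriv (deriv γ₂) r := fun r => by
      rw [hd]
      exact deriv_fun_sub (h₁'.differentiable one_ne_zero r) (h₂'.differentiable one_ne_zero r)
    have := norm_le_of_norm_deriv_deriv_le (h₁.sub h₂) hst (M := K * m)
      (fun r hr => by rw [hdd]; exact hm r hr) (sub_eq_zero.2 hs) (sub_eq_zero.2 ht) τ hτ
    calc ‖γ₁ τ - γ₂ τ‖ ≤ 2 * (K * m) * (t - s) ^ 2 := this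
      _ = 2 * K * (t - s) ^ 2 * m := by ring
      _ ≤ 1 / 2 * m := by gcongr
  have h_force : ∀ u : C(Icc s t, E), Continuous fun τ => F τ (u (projIcc s t hst.le τ)) :=
    fun u => hF.comp (continuous_id.prodMk (u.continuous.comp continuous_projIcc))
  choose Ψ hΨ hΨ_deriv hΨ_left hΨ_right using
    fun u : C(Icc s t, E) => exists_contDiff_two_deriv_deriv_eq (h_force u) hst x y
  let T : C(Icc s t, E) → C(Icc s t, E) := fun u =>
    ⟨fun τ => Ψ u τ, (hΨ u).continuous.comp continuous_subtype_val⟩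
  have hT : ContractingWith (1 / 2) T := by
    refine ⟨by rw [← NNReal.coe_lt_coe]; norm_num, LipschitzWith.of_dist_le_mul fun u v => ?_⟩
    rw [ContinuousMap.dist_le (by positivity)]
    intro τ
    rw [dist_eq_norm]
    have := h_compare (hΨ u) (hΨ v) ((hΨ_left u).trans (hΨ_left v).symm)
      ((hΨ_right u).trans (hΨ_right v).symm) (m := dist u v) (fun r _ => by
        rw [hΨ_deriv, hΨ_deriv, ← dist_eq_norm]
        refine ((hK r).dist_le_mul _ _).trans ?_
        gcongr
        exact ContinuousMap.dist_apply_le_dist _) dist_nonneg τ τ.2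
    simpa [T] using this
  set u := hT.fixedPoint T
  have hu : T u = u := hT.fixedPoint_isFixedPt
  have h_eq : ∀ τ ∈ Icc s t, deriv (deriv (Ψ u)) τ = F τ (Ψ u τ) := fun τ hτ => by
    rw [hΨ_deriv, projIcc_of_mem _ hτ]
    exact congrArg (F τ) (DFunLike.congr_fun hu ⟨τ, hτ⟩).symm
  refine ⟨Ψ u, ⟨hΨ u, h_eq, hΨ_left u, hΨ_right u⟩, ?_⟩
  rintro γ' ⟨hγ', h_eq', h_left, h_right⟩ τ hτ
  obtain ⟨r, hr, hr_max⟩ := isCompact_Icc.exists_isMaxOn (nonempty_Icc.2 hst.le)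
    ((hγ'.continuous.sub (hΨ u).continuous).norm.continuousOn)
  have hr_le : ‖γ' r - Ψ u r‖ ≤ 1 / 2 * ‖γ' r - Ψ u r‖ := by
    refine h_compare hγ' (hΨ u) (h_left.trans (hΨ_left u).symm) (h_right.trans (hΨ_right u).symm)
      (fun σ hσ => ?_) (norm_nonneg _) r hr
    rw [h_eq' σ hσ, h_eq σ hσ]
    refine ((hK σ).norm_sub_le _ _).trans ?_
    gcongr
    exact hr_max hσ
  have h_le : ‖γ' τ - Ψ u τ‖ ≤ ‖γ' r - Ψ u r‖ := hr_max hτ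
  have : ‖γ' τ - Ψ u τ‖ ≤ 0 := by linarith
  exact sub_eq_zero.1 (norm_le_zero_iff.1 this)

end BoundaryValueProblem

/-- A bound on the second derivative makes the gradient Lipschitz. -/
theorem lipschitzWith_gradient_of_norm_iteratedFDeriv_two_le {E : Type*} [NormedAddCommGroup E]
    [InnerProductSpace ℝ E] [CompleteSpace E] {f : E → ℝ} (hf : ContDiff ℝ 2 f) {C : NNReal}
    (hC : ∀ x, ‖iteratedFDeriv ℝ 2 f x‖ ≤ C) : LipschitzWith C (gradient f) := by
  have hf' : ContDiff ℝ 1 (fderiv ℝ f) := hf.fderiv_right (by norm_num)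
  have h : LipschitzWith C (fderiv ℝ f) := by
    refine lipschitzWith_of_nnnorm_fderiv_le (𝕜 := ℝ) (hf'.differentiable one_ne_zero) fun x => ?_
    rw [← NNReal.coe_le_coe, coe_nnnorm, ← norm_iteratedFDeriv_one, norm_iteratedFDeriv_fderiv]
    exact hC x
  have := (InnerProductSpace.toDual ℝ E).symm.lipschitz.comp h
  rwa [one_mul] at this

/-- Joint continuity of the first iterated derivative gives joint continuity of the gradient. -/
theorem continuous_gradient_of_continuous_iteratedFDeriv_one {X E : Type*} [TopologicalSpace X]
    [NormedAddCommGroup E] [InnerProductSpace ℝ E] [FiniteDimensional ℝ E] [CompleteSpace E]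
    {f : X → E → ℝ} (hf : Continuous fun p : X × E => iteratedFDeriv ℝ 1 (f p.1) p.2) :
    Continuous fun p : X × E => gradient (f p.1) p.2 := by
  refine (InnerProductSpace.toDual ℝ E).symm.continuous.comp (continuous_clm_apply.2 fun v => ?_)
  simpa [Function.comp_def] using
    (ContinuousMultilinearMap.apply ℝ (fun _ : Fin 1 => E) ℝ fun _ => v).continuous.comp hf

/-- **Short-time existence and uniqueness of classical trajectories** for the boundary value
problem of Newton's equation `γ'' = -∇ₓV(τ, γ(τ))`, under Fujiwara's Assumption (A):
`V` has continuous space-derivatives of every order, jointly continuous in `(t,x)`,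
and all space-derivatives of order `≥ 2` are bounded. -/
theorem classical_path_short_time_existence_uniqueness
    {d : ℕ} (hd : 1 ≤ d)
    (V : ℝ × EuclideanSpace ℝ (Fin d) → ℝ)
    (hV_smooth : ∀ t : ℝ, ContDiff ℝ (⊤ : ℕ∞) fun x => V (t, x))
    (hV_cont : ∀ n : ℕ, Continuous fun p : ℝ × EuclideanSpace ℝ (Fin d) =>
      iteratedFDeriv ℝ n (fun x => V (p.1, x)) p.2)
    (hV_bd : ∀ n : ℕ, 2 ≤ n → ∃ C > 0, ∀ (t : ℝ) (x : EuclideanSpace ℝ (Fin d)),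
      ‖iteratedFDeriv ℝ n (fun x => V (t, x)) x‖ ≤ C) :
    ∃ δ > (0 : ℝ), ∀ s t : ℝ, s < t → t - s ≤ δ →
      ∀ x y : EuclideanSpace ℝ (Fin d),
        ∃ γ : ℝ → EuclideanSpace ℝ (Fin d),
          (ContDiff ℝ 2 γ ∧
            (∀ τ ∈ Icc s t, deriv (deriv γ) τ = -gradient (fun v => V (τ, v)) (γ τ)) ∧
            γ s = y ∧ γ t = x) ∧
          (∀ γ' : ℝ → EuclideanSpace ℝ (Fin d),
            (ContDiff ℝ 2 γ' ∧
              (∀ τ ∈ Icc s t, deriv (deriv γ') τ = -gradient (fun v => V (τ, v)) (γ' τ)) ∧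
              γ' s = y ∧ γ' t = x) →
            ∀ τ ∈ Icc s t, γ' τ = γ τ) := by
  obtain ⟨C, hC, hC_bd⟩ := hV_bd 2 le_rfl
  lift C to NNReal using hC.le
  refine ⟨1 / (2 * (C + 1)), by positivity, fun s t hst hδ x y => ?_⟩
  refine exists_unique_boundary_value_problem (F := fun τ v => -gradient (fun v => V (τ, v)) v)
    (K := C) ?_ (fun τ => ?_) hst ?_ x y
  · exact (continuous_gradient_of_continuous_iteratedFDeriv_one
      (f := fun τ v => V (τ, v)) (hV_cont 1)).neg
  · exact (lipschitzWith_gradient_of_norm_iteratedFDeriv_two_le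
      ((hV_smooth τ).of_le (WithTop.coe_le_coe.2 le_top)) (hC_bd τ)).neg
  · have hL : 0 ≤ t - s := (sub_pos.2 hst).le
    calc 2 * (C : ℝ) * (t - s) ^ 2 ≤ 2 * C * (1 / (2 * (C + 1))) ^ 2 := by gcongr
      _ ≤ 1 / 2 := by
        rw [div_pow, one_pow, mul_one_div, div_le_div_iff₀ (by positivity) (by positivity)]
        nlinarith [sq_nonneg (C : ℝ)]
end
end

section
/- Let d ≥ 1, let φ ∈ 𝓢(ℝ^d) be a Schwartz function, and let t ∈ ℝ, t ≠ 0. Then for every x ∈ ℝ^d, 𝓕^{−1}[ ξ ↦ e^{−2π² i t |ξ|²} (𝓕φ)(ξ) ](x) = e^{−iπ d · sgn(t)/4} (2π|t|)^{−d/2} ∫_{ℝ^d} e^{ i|x−y|²/(2t) } φ(y) dy, where the integral on the right is absolutely convergent. (This is the Fresnel integral representation of the free Schrödinger propagator e^{itΔ/2}: its Fourier multiplier e^{−2π² i t|ξ|²} equals the integral operator with kernel (2πit)^{−d/2} e^{i|x−y|²/(2t)}.) -/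
open MeasureTheory Real Filter
open scoped RealInnerProductSpace

noncomputable section

open scoped FourierTransform Topology

section FresnelKernel

variable {V : Type*} [NormedAddCommGroup V] [InnerProductSpace ℝ V] [MeasurableSpace V]
  [BorelSpace V] [FiniteDimensional ℝ V]

/-- Multiplying the Fourier transform of `f` by a modulated Gaussian and integrating amounts to
integrating `f` against a translated heat kernel. -/
theorem integral_gaussian_mul_fourier {f : V → ℂ} (hf : Integrable f) {b : ℂ} (hb : 0 < b.re)
    (x : V) :
    ∫ ξ : V, Complex.exp (-b * ‖ξ‖ ^ 2 + 2 * π * Complex.I * ⟪x, ξ⟫) * 𝓕 f ξ =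
      (π / b) ^ (Module.finrank ℝ V / 2 : ℂ) *
        ∫ y : V, Complex.exp (-π ^ 2 * ‖x - y‖ ^ 2 / b) * f y := by
  have hG : Integrable fun ξ : V ↦
      Complex.exp (-b * ‖ξ‖ ^ 2 + 2 * π * Complex.I * ⟪x, ξ⟫) :=
    GaussianFourier.integrable_cexp_neg_mul_sq_norm_add hb _ _
  have hswap : ∫ y : V,
        𝓕 (fun ξ : V ↦ Complex.exp (-b * ‖ξ‖ ^ 2 + 2 * π * Complex.I * ⟪x, ξ⟫)) y * f y =
      ∫ ξ : V, Complex.exp (-b * ‖ξ‖ ^ 2 + 2 * π * Complex.I * ⟪x, ξ⟫) * 𝓕 f ξ := by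
    simpa using! VectorFourier.integral_fourierIntegral_smul_eq_flip (L := innerₗ V)
      Real.continuous_fourierChar continuous_inner hG hf
  rw [← hswap, ← integral_const_mul]
  congr with y
  rw [fourier_gaussian_innerProductSpace' hb, mul_assoc]

/-- If the numbers `c l` of nonpositive real part tend to `c₀`, then the integrals of
`exp (c l * q) * f`, with `q` nonnegative, tend to the integral of `exp (c₀ * q) * f`. -/
theorem tendsto_integral_cexp_mul {α ι : Type*} [MeasurableSpace α] {μ : Measure α}
    {l : Filter ι} [l.IsCountablyGenerated] {f : α → ℂ} (hf : Integrable f μ)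
    {q : α → ℝ} (hq : Measurable q) (hq₀ : ∀ y, 0 ≤ q y) {c : ι → ℂ} {c₀ : ℂ}
    (hc : Tendsto c l (𝓝 c₀)) (hre : ∀ᶠ i in l, (c i).re ≤ 0) :
    Tendsto (fun i ↦ ∫ y, Complex.exp (c i * q y) * f y ∂μ) l
      (𝓝 (∫ y, Complex.exp (c₀ * q y) * f y ∂μ)) := by
  refine tendsto_integral_filter_of_dominated_convergence (fun y ↦ ‖f y‖) ?_ ?_ hf.norm ?_
  · exact .of_forall fun i ↦
      (by fun_prop : Measurable fun y ↦ Complex.exp (c i * q y)).aestronglyMeasurable.mul hf.1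
  · filter_upwards [hre] with i hi
    refine .of_forall fun y ↦ ?_
    rw [norm_mul, Complex.norm_exp, Complex.re_mul_ofReal]
    exact mul_le_of_le_one_left (norm_nonneg _)
      (Real.exp_le_one_iff.2 (mul_nonpos_of_nonpos_of_nonneg hi (hq₀ y)))
  · exact .of_forall fun y ↦ ((hc.mul_const _).cexp).mul_const _

/-- The principal branch of `(2πit)⁻¹` raised to the power `s`. -/
theorem inv_two_pi_I_mul_cpow {t : ℝ} (ht : t ≠ 0) (s : ℝ) :
    ((π : ℂ) / (2 * π ^ 2 * t * Complex.I)) ^ (s : ℂ) =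
      Complex.exp (-((π * s * Real.sign t / 2 : ℝ) * Complex.I)) *
        ((2 * π * |t|) ^ (-s) : ℝ) := by
  have hpos : 0 < 2 * π * |t| := by positivity
  have hexp : Complex.exp ((-Real.log (2 * π * |t|) : ℝ) +
      (-(π / 2 * Real.sign t) : ℝ) * Complex.I) = (π : ℂ) / (2 * π ^ 2 * t * Complex.I) := by
    have hπ : (π : ℂ) ≠ 0 := by exact_mod_cast pi_ne_zero
    have ht' : (t : ℂ) ≠ 0 := by exact_mod_cast ht
    rw [Complex.exp_add, ← Complex.ofReal_exp, Real.exp_neg, Real.exp_log hpos]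
    rcases ht.lt_or_gt with h | h
    · rw [Real.sign_of_neg h, abs_of_neg h]
      have : ((-(π / 2 * -1) : ℝ) : ℂ) * Complex.I = π / 2 * Complex.I := by push_cast; ring
      rw [this, Complex.exp_pi_div_two_mul_I]
      push_cast
      field_simp
      simp
    · rw [Real.sign_of_pos h, abs_of_pos h]
      have : ((-(π / 2 * 1) : ℝ) : ℂ) * Complex.I = -π / 2 * Complex.I := by push_cast; ring
      rw [this, Complex.exp_neg_pi_div_two_mul_I]
      push_cast
      field_simp
      simp
  have hsign : |Real.sign t| ≤ 1 := by
    rcases ht.lt_or_gt with h | h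
    · simp [Real.sign_of_neg h]
    · simp [Real.sign_of_pos h]
  have him := abs_le.1 hsign
  rw [← hexp, Complex.cpow_def_of_ne_zero (Complex.exp_ne_zero _), Complex.log_exp,
    Real.rpow_def_of_pos hpos, Complex.ofReal_exp, ← Complex.exp_add]
  · congr 1
    push_cast
    ring
  · simp only [Complex.add_im, Complex.ofReal_im, Complex.im_ofReal_mul, Complex.I_im]
    nlinarith [pi_pos]
  · simp only [Complex.add_im, Complex.ofReal_im, Complex.im_ofReal_mul, Complex.I_im]
    nlinarith [pi_pos]

/-- The Fresnel representation for an integrable function with integrable Fourier transform. -/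
theorem integral_fresnel_multiplier_mul_fourier {f : V → ℂ} (hf : Integrable f)
    (hf' : Integrable (𝓕 f)) {t : ℝ} (ht : t ≠ 0) (x : V) :
    ∫ ξ : V, Complex.exp (-(2 * π ^ 2 * t * Complex.I) * (‖ξ‖ ^ 2 : ℝ)) *
        (Complex.exp (2 * π * Complex.I * ⟪x, ξ⟫) * 𝓕 f ξ) =
      (π / (2 * π ^ 2 * t * Complex.I)) ^ (Module.finrank ℝ V / 2 : ℂ) *
        ∫ y : V, Complex.exp
          (-π ^ 2 / (2 * π ^ 2 * t * Complex.I) * (‖x - y‖ ^ 2 : ℝ)) * f y := by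
  set b₀ : ℂ := 2 * π ^ 2 * t * Complex.I with hb₀
  have hb₀re : b₀.re = 0 := by
    rw [hb₀, show (2 * π ^ 2 * t * Complex.I : ℂ) = (2 * π ^ 2 * t : ℝ) * Complex.I by
      push_cast; rfl, Complex.re_ofReal_mul]
    simp
  have hb₀ne : b₀ ≠ 0 := by simp [hb₀, ht, pi_ne_zero]
  have hb : Tendsto (fun ε : ℝ ↦ (ε : ℂ) + b₀) (𝓝[>] 0) (𝓝 b₀) := by
    have : Continuous fun ε : ℝ ↦ (ε : ℂ) + b₀ := by fun_prop
    simpa using (this.tendsto 0).mono_left nhdsWithin_le_nhds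
  have hbre : ∀ᶠ ε : ℝ in 𝓝[>] 0, 0 < ((ε : ℂ) + b₀).re := by
    filter_upwards [self_mem_nhdsWithin] with ε hε
    simpa [hb₀re] using hε
  have hg : Integrable fun ξ : V ↦ Complex.exp (2 * π * Complex.I * ⟪x, ξ⟫) * 𝓕 f ξ := by
    refine hf'.bdd_mul (c := 1) (Continuous.aestronglyMeasurable (by fun_prop)) (.of_forall fun ξ ↦ ?_)
    simp [Complex.norm_exp]
  have hleft := tendsto_integral_cexp_mul hg (q := fun ξ : V ↦ ‖ξ‖ ^ 2) (by fun_prop)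
    (fun _ ↦ by positivity) hb.neg (hbre.mono fun ε hε ↦ by
      rw [Complex.neg_re]
      exact neg_nonpos.2 hε.le)
  have hkernel := tendsto_integral_cexp_mul hf (q := fun y : V ↦ ‖x - y‖ ^ 2) (by fun_prop)
    (fun _ ↦ by positivity) ((tendsto_const_nhds (x := (-π ^ 2 : ℂ))).div hb hb₀ne) (hbre.mono fun ε hε ↦ by
      rw [Pi.div_apply, show (-π ^ 2 : ℂ) = ((-π ^ 2 : ℝ) : ℂ) by push_cast; rfl, div_eq_mul_inv,
        Complex.re_ofReal_mul, Complex.inv_re]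
      exact mul_nonpos_of_nonpos_of_nonneg (by nlinarith [sq_nonneg π])
        (div_nonneg hε.le (Complex.normSq_nonneg _)))
  have hslit : (π : ℂ) / b₀ ∈ Complex.slitPlane := by
    have : (π : ℂ) / b₀ = (-(1 / (2 * π * t)) : ℝ) * Complex.I := by
      have hπ : (π : ℂ) ≠ 0 := by exact_mod_cast pi_ne_zero
      have ht' : (t : ℂ) ≠ 0 := by exact_mod_cast ht
      rw [hb₀]
      push_cast
      field_simp
      simp
    refine Complex.mem_slitPlane_iff.2 (Or.inr ?_)
    rw [this, Complex.im_ofReal_mul, Complex.I_im, mul_one]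
    exact neg_ne_zero.2 (by positivity)
  have hconst := ((tendsto_const_nhds (x := (π : ℂ))).div hb hb₀ne).cpow
    (tendsto_const_nhds (x := (Module.finrank ℝ V / 2 : ℂ))) hslit
  refine tendsto_nhds_unique hleft ((hconst.mul hkernel).congr' ?_)
  filter_upwards [hbre] with ε hε
  have key := integral_gaussian_mul_fourier hf hε x
  simp only [Complex.exp_add, mul_assoc] at key
  simp only [Pi.div_apply, Complex.ofReal_pow, mul_assoc, key, div_mul_eq_mul_div]

end FresnelKernel

/-- **Fresnel integral representation of the free Schrödinger propagator** `e^{itΔ/2}`: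
its Fourier multiplier `e^{-2π² i t |ξ|²}` equals the integral operator with kernel
`(2πit)^{-d/2} e^{i|x-y|²/(2t)}`, with the branch
`(2πit)^{-d/2} = e^{-iπ d sgn(t)/4} (2π|t|)^{-d/2}`. The Fourier transform is
`𝓕f(ξ) = ∫ e^{-2πi ξ·x} f(x) dx`, with inverse `𝓕⁻¹h(x) = ∫ e^{2πi x·ξ} h(ξ) dξ`. -/
theorem fresnel_representation_free_propagator
    {d : ℕ} (hd : 1 ≤ d) (φ : SchwartzMap (EuclideanSpace ℝ (Fin d)) ℂ)
    (t : ℝ) (ht : t ≠ 0) (x : EuclideanSpace ℝ (Fin d)) :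
    Integrable (fun y : EuclideanSpace ℝ (Fin d) =>
      Complex.exp (Complex.I * ((‖x - y‖ ^ 2 / (2 * t) : ℝ) : ℂ)) * φ y) ∧
    (∫ (ξ : EuclideanSpace ℝ (Fin d)),
        Complex.exp (((2 * π * ⟪x, ξ⟫ : ℝ) : ℂ) * Complex.I) *
          (Complex.exp (-(((2 * π ^ 2 * t * ‖ξ‖ ^ 2 : ℝ) : ℂ) * Complex.I)) *
            ∫ (y : EuclideanSpace ℝ (Fin d)),
              Complex.exp (-(((2 * π * ⟪ξ, y⟫ : ℝ) : ℂ) * Complex.I)) * φ y)) =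
      Complex.exp (-(((π * d * Real.sign t / 4 : ℝ) : ℂ) * Complex.I)) *
        (((2 * π * |t|) ^ (-(d : ℝ) / 2) : ℝ) : ℂ) *
        ∫ (y : EuclideanSpace ℝ (Fin d)),
          Complex.exp (Complex.I * ((‖x - y‖ ^ 2 / (2 * t) : ℝ) : ℂ)) * φ y := by
  have hfin : Module.finrank ℝ (EuclideanSpace ℝ (Fin d)) = d := by simp
  have key := integral_fresnel_multiplier_mul_fourier φ.integrable
    (f := φ) (𝓕 φ).integrable ht x
  refine ⟨?_, ?_⟩
  · refine φ.integrable.bdd_mul (c := 1) (Continuous.aestronglyMeasurable (by fun_prop))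
      (.of_forall fun y ↦ ?_)
    rw [mul_comm, Complex.norm_exp_ofReal_mul_I]
  · have hbranch : Complex.exp (-(((π * d * Real.sign t / 4 : ℝ) : ℂ) * Complex.I)) *
        (((2 * π * |t|) ^ (-(d : ℝ) / 2) : ℝ) : ℂ) =
        (π / (2 * π ^ 2 * t * Complex.I)) ^ (d / 2 : ℂ) := by
      rw [show (d / 2 : ℂ) = ((d / 2 : ℝ) : ℂ) by push_cast; rfl, inv_two_pi_I_mul_cpow ht]
      congr 4 <;> ring_nf
    have hkernel (y : EuclideanSpace ℝ (Fin d)) :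
        Complex.I * ((‖x - y‖ ^ 2 / (2 * t) : ℝ) : ℂ) =
          -π ^ 2 / (2 * π ^ 2 * t * Complex.I) * (‖x - y‖ ^ 2 : ℝ) := by
      have hπ : (π : ℂ) ≠ 0 := by exact_mod_cast pi_ne_zero
      have ht' : (t : ℂ) ≠ 0 := by exact_mod_cast ht
      push_cast
      field_simp
      simp
    rw [hbranch]
    simp_rw [hkernel]
    rw [hfin] at key
    rw [← key]
    congr with ξ
    rw [Real.fourier_eq', mul_left_comm]
    congr 2
    · push_cast
      ring_nf
    · push_cast
      ring_nf
    · congr with y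
      rw [smul_eq_mul, real_inner_comm]
      push_cast
      ring_nf
end
end

section
/- Let d ≥ 1 and φ ∈ 𝓢(ℝ^d). For t ∈ (0, π) and x ∈ ℝ^d define ψ(t,x) = e^{−iπd/4} (2π sin t)^{−d/2} ∫_{ℝ^d} exp( i ( (|x|² + |y|²) cos t − 2 x·y ) / (2 sin t) ) φ(y) dy (the integral is absolutely convergent). Then ψ is smooth on (0,π) × ℝ^d and satisfies the harmonic oscillator Schrödinger equation i ∂_t ψ(t,x) = −(1/2) Δ_x ψ(t,x) + (1/2)|x|² ψ(t,x) for all (t,x) ∈ (0,π) × ℝ^d, and ψ(t,·) → φ in L²(ℝ^d) as t → 0⁺. -/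
open MeasureTheory Real Set Filter Topology
open scoped RealInnerProductSpace ENNReal

noncomputable section
/-- The Laplacian of `f : ℝ^d → ℂ`, as the sum of the second partial derivatives
along the coordinate directions. -/
def euclideanLaplacian {d : ℕ} (f : EuclideanSpace ℝ (Fin d) → ℂ)
    (x : EuclideanSpace ℝ (Fin d)) : ℂ :=
  ∑ i : Fin d, fderiv ℝ (fun y => fderiv ℝ f y (EuclideanSpace.single i 1)) x
    (EuclideanSpace.single i 1)

section QuadraticPhase

variable {E : Type*} [NormedAddCommGroup E]

lemma hasDerivAt_cexp_I_mul (u : ℝ) :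
    HasDerivAt (fun u : ℝ => Complex.exp (Complex.I * u))
      (Complex.I * Complex.exp (Complex.I * u)) u := by
  have h := ((Complex.ofRealCLM.hasDerivAt (x := u)).const_mul Complex.I).cexp
  simpa [mul_comm] using h

lemma iteratedDeriv_cexp_I_mul (n : ℕ) :
    iteratedDeriv n (fun u : ℝ => Complex.exp (Complex.I * u)) =
      fun u : ℝ => Complex.I ^ n * Complex.exp (Complex.I * u) := by
  induction n with
  | zero => simp
  | succ n ih =>
    ext u
    rw [iteratedDeriv_succ, ih, ((hasDerivAt_cexp_I_mul u).const_mul _).deriv]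
    ring

lemma hasTemperateGrowth_cexp_I_mul :
    Function.HasTemperateGrowth (fun u : ℝ => Complex.exp (Complex.I * u)) := by
  refine ⟨(contDiff_const.mul Complex.ofRealCLM.contDiff).cexp, fun n => ⟨0, 1, fun x => ?_⟩⟩
  rw [norm_iteratedFDeriv_eq_norm_iteratedDeriv, iteratedDeriv_cexp_I_mul]
  simp [mul_comm Complex.I, Complex.norm_exp_ofReal_mul_I]

/-- The unimodular quadratic phase `exp (i a |x|²)`. -/
def quadraticPhase (a : ℝ) (x : E) : ℂ := Complex.exp (Complex.I * (a * ‖x‖ ^ 2 : ℝ))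

@[simp]
lemma norm_quadraticPhase (a : ℝ) (x : E) : ‖quadraticPhase a x‖ = 1 := by
  rw [quadraticPhase, mul_comm, Complex.norm_exp_ofReal_mul_I]

lemma norm_quadraticPhase_sub_one_le (a : ℝ) (x : E) :
    ‖quadraticPhase a x - 1‖ ≤ |a| * ‖x‖ ^ 2 := by
  have h := Real.norm_exp_I_mul_ofReal_sub_one_le (x := a * ‖x‖ ^ 2)
  simpa [quadraticPhase] using h

variable [InnerProductSpace ℝ E]

lemma hasTemperateGrowth_quadraticPhase (a : ℝ) :
    Function.HasTemperateGrowth (quadraticPhase a : E → ℂ) := by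
  have h : Function.HasTemperateGrowth (fun x : E => a * ‖x‖ ^ 2) :=
    (Function.HasTemperateGrowth.const a).mul (Function.hasTemperateGrowth_norm_sq E)
  exact hasTemperateGrowth_cexp_I_mul.comp h

lemma hasFDerivAt_quadraticPhase (a : ℝ) (x : E) :
    HasFDerivAt (quadraticPhase a : E → ℂ)
      ((2 * Complex.I * a * quadraticPhase a x) • Complex.ofRealCLM.comp (innerSL ℝ x)) x := by
  have h := (hasDerivAt_cexp_I_mul (a * ‖x‖ ^ 2)).hasFDerivAt.comp x
    ((hasStrictFDerivAt_norm_sq x).hasFDerivAt.const_mul a)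
  refine h.congr_fderiv ?_
  ext v
  simp [quadraticPhase]
  ring

/-- Multiplication of Schwartz functions by a quadratic phase. -/
def phaseMul (a : ℝ) : SchwartzMap E ℂ →L[ℂ] SchwartzMap E ℂ :=
  SchwartzMap.smulLeftCLM ℂ (quadraticPhase a)

@[simp]
lemma phaseMul_apply (a : ℝ) (f : SchwartzMap E ℂ) (x : E) :
    phaseMul a f x = quadraticPhase a x * f x := by
  simp [phaseMul, hasTemperateGrowth_quadraticPhase]

lemma fderiv_quadraticPhase_mul (a : ℝ) {H : E → ℂ} {x : E} (hH : DifferentiableAt ℝ H x)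
    (e : E) :
    fderiv ℝ (fun y => quadraticPhase a y * H y) x e =
      quadraticPhase a x * (2 * Complex.I * a * ⟪x, e⟫ * H x + fderiv ℝ H x e) := by
  have h : HasFDerivAt (fun y => quadraticPhase a y * H y) _ x :=
    (hasFDerivAt_quadraticPhase a x).mul hH.hasFDerivAt
  rw [h.fderiv]
  simp
  ring

end QuadraticPhase

section L2

variable {E : Type*} [NormedAddCommGroup E] [InnerProductSpace ℝ E] [FiniteDimensional ℝ E]
  [MeasurableSpace E] [BorelSpace E]

open scoped FourierTransform

lemma eLpNorm_phaseMul_sub_le (a : ℝ) (u f : SchwartzMap E ℂ) :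
    eLpNorm (⇑(phaseMul a u - f)) 2 volume ≤
      eLpNorm (⇑(u - f)) 2 volume + eLpNorm (⇑(phaseMul a f - f)) 2 volume := by
  have h1 : phaseMul a u - f = phaseMul a (u - f) + (phaseMul a f - f) := by
    rw [map_sub]; abel
  have h2 : eLpNorm (⇑(phaseMul a (u - f))) 2 volume = eLpNorm (⇑(u - f)) 2 volume :=
    eLpNorm_congr_norm_ae (ae_of_all _ fun x => by rw [phaseMul_apply]; simp)
  rw [h1, ← h2]
  exact eLpNorm_add_le (SchwartzMap.continuous _).aestronglyMeasurable
    (SchwartzMap.continuous _).aestronglyMeasurable (by norm_num)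

lemma eLpNorm_fourier_eq (f : SchwartzMap E ℂ) :
    eLpNorm (⇑(𝓕 f : SchwartzMap E ℂ)) 2 volume = eLpNorm (⇑f) 2 volume := by
  have h := SchwartzMap.norm_fourier_toL2_eq f
  rwa [SchwartzMap.norm_toLp, SchwartzMap.norm_toLp, ENNReal.toReal_eq_toReal_iff'
    ((𝓕 f : SchwartzMap E ℂ).memLp 2 volume).eLpNorm_ne_top
    (f.memLp 2 volume).eLpNorm_ne_top] at h

lemma eLpNorm_fourierInv_sub_eq (u f : SchwartzMap E ℂ) :
    eLpNorm (⇑((𝓕⁻ u : SchwartzMap E ℂ) - f)) 2 volume =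
      eLpNorm (⇑(u - (𝓕 f : SchwartzMap E ℂ))) 2 volume := by
  have h : (𝓕 ((𝓕⁻ u : SchwartzMap E ℂ) - f) : SchwartzMap E ℂ) = u - 𝓕 f := by
    rw [sub_eq_add_neg, FourierTransform.fourier_add, FourierTransform.fourier_neg]
    simp [sub_eq_add_neg]
  rw [← eLpNorm_fourier_eq, h]

lemma tendsto_eLpNorm_phaseMul_sub (f : SchwartzMap E ℂ) :
    Tendsto (fun a => eLpNorm (⇑(phaseMul a f - f)) 2 volume) (𝓝 0) (𝓝 0) := by
  have hg : Function.HasTemperateGrowth (fun x : E => ((‖x‖ ^ 2 : ℝ) : ℂ)) :=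
    Function.Complex.hasTemperateGrowth_ofReal.comp (Function.hasTemperateGrowth_norm_sq E)
  obtain ⟨g, hgf⟩ : ∃ g : SchwartzMap E ℂ, ∀ x, g x = ((‖x‖ ^ 2 : ℝ) : ℂ) * f x :=
    ⟨SchwartzMap.smulLeftCLM ℂ (fun x : E => ((‖x‖ ^ 2 : ℝ) : ℂ)) f,
      fun x => SchwartzMap.smulLeftCLM_apply_apply hg f x⟩
  have hle (a : ℝ) : eLpNorm (⇑(phaseMul a f - f)) 2 volume ≤
      ENNReal.ofReal |a| * eLpNorm (⇑g) 2 volume := by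
    refine eLpNorm_le_mul_eLpNorm_of_ae_le_mul (ae_of_all _ fun x => ?_) 2
    have h : (phaseMul a f - f) x = (quadraticPhase a x - 1) * f x := by
      rw [sub_apply, phaseMul_apply]; ring
    have h2 : ‖g x‖ = ‖x‖ ^ 2 * ‖f x‖ := by
      simp [hgf]
    rw [h, norm_mul, h2, ← mul_assoc]
    gcongr
    exact norm_quadraticPhase_sub_one_le a x
  refine tendsto_of_tendsto_of_tendsto_of_le_of_le tendsto_const_nhds ?_ (fun _ => zero_le) hle
  have h0 : Tendsto (fun a : ℝ => ENNReal.ofReal |a|) (𝓝 0) (𝓝 0) := by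
    have : Continuous (fun a : ℝ => ENNReal.ofReal |a|) :=
      ENNReal.continuous_ofReal.comp continuous_abs
    simpa using this.tendsto 0
  simpa using ENNReal.Tendsto.mul_const (b := eLpNorm (⇑g) 2 volume) h0
    (Or.inr (g.memLp 2 volume).eLpNorm_ne_top)

end L2

section FreePropagator

variable {E : Type*} [NormedAddCommGroup E] [InnerProductSpace ℝ E] [FiniteDimensional ℝ E]
  [MeasurableSpace E] [BorelSpace E]

open scoped FourierTransform

lemma integral_gaussian_mul_eq {β : ℂ} (hβ : 0 < β.re) (g : SchwartzMap E ℂ) (x : E) :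
    (π / β) ^ (Module.finrank ℝ E / 2 : ℂ) *
        ∫ y, Complex.exp (-π ^ 2 * ‖x - y‖ ^ 2 / β) * g y =
      ∫ v, Complex.exp (-β * ‖v‖ ^ 2 + 2 * π * Complex.I * ⟪x, v⟫) * 𝓕 (⇑g) v := by
  have hint : Integrable
      (fun v : E => Complex.exp (-β * ‖v‖ ^ 2 + 2 * π * Complex.I * ⟪x, v⟫)) :=
    GaussianFourier.integrable_cexp_neg_mul_sq_norm_add hβ _ _
  have h := VectorFourier.integral_fourierIntegral_smul_eq_flip (L := innerₗ E)
    Real.continuous_fourierChar continuous_inner hint (g.integrable (μ := volume))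
  rw [flip_innerₗ] at h
  change ∫ y, 𝓕 (fun v : E => Complex.exp (-β * ‖v‖ ^ 2 + 2 * π * Complex.I * ⟪x, v⟫)) y • g y =
    ∫ v, _ • 𝓕 (⇑g) v at h
  simp only [fourier_gaussian_innerProductSpace' hβ, smul_eq_mul] at h
  rw [← h, ← integral_const_mul]
  congr 1 with y
  ring

lemma integral_oscillating_gaussian_mul_eq {s : ℝ} (hs : 0 < s) (g : SchwartzMap E ℂ) (x : E) :
    (1 / (2 * π * s * Complex.I)) ^ (Module.finrank ℝ E / 2 : ℂ) *
        ∫ y, Complex.exp (Complex.I * (‖x - y‖ ^ 2 / (2 * s) : ℝ)) * g y =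
      𝓕⁻ (phaseMul (-(2 * π ^ 2 * s)) (𝓕 g)) x := by
  have hπ := Real.pi_pos
  have hs' : (s : ℂ) ≠ 0 := by exact_mod_cast hs.ne'
  have hπ' : (π : ℂ) ≠ 0 := by exact_mod_cast hπ.ne'
  set b : ℂ := 2 * π ^ 2 * s * Complex.I with hb
  have hb0 : b ≠ 0 := by simp [b, hs', hπ']
  have hβ : Tendsto (fun ε : ℝ => (ε : ℂ) + b) (𝓝[>] 0) (𝓝 b) := by
    have : Continuous (fun ε : ℝ => (ε : ℂ) + b) := by fun_prop
    simpa using (this.tendsto 0).mono_left nhdsWithin_le_nhds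
  have hre : b.re = 0 := by
    have : b = ((2 * π ^ 2 * s : ℝ) : ℂ) * Complex.I := by rw [hb]; push_cast; ring
    rw [this, Complex.re_ofReal_mul, Complex.I_re, mul_zero]
  have hpos : ∀ᶠ ε : ℝ in 𝓝[>] 0, 0 < ((ε : ℂ) + b).re := by
    filter_upwards [self_mem_nhdsWithin] with ε hε
    simpa [hre] using hε
  have hl : Tendsto (fun ε : ℝ => (π / ((ε : ℂ) + b)) ^ (Module.finrank ℝ E / 2 : ℂ) *
      ∫ y, Complex.exp (-π ^ 2 * ‖x - y‖ ^ 2 / ((ε : ℂ) + b)) * g y) (𝓝[>] 0)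
      (𝓝 ((π / b) ^ (Module.finrank ℝ E / 2 : ℂ) *
        ∫ y, Complex.exp (-π ^ 2 * ‖x - y‖ ^ 2 / b) * g y)) := by
    refine Tendsto.mul ?_ ?_
    · refine Tendsto.cpow (tendsto_const_nhds.div hβ hb0) tendsto_const_nhds (Or.inr ?_)
      have : π / b = ((1 / (2 * π * s) : ℝ) : ℂ) * -Complex.I := by
        rw [hb]; push_cast; field_simp; simp
      rw [this, Complex.im_ofReal_mul]
      simp [hs.ne', hπ.ne']
    · refine tendsto_integral_filter_of_dominated_convergence (fun y => ‖g y‖) ?_ ?_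
        g.integrable.norm ?_
      · refine Eventually.of_forall fun ε => Continuous.aestronglyMeasurable ?_
        have := g.continuous
        fun_prop
      · filter_upwards [hpos] with ε hε
        refine ae_of_all _ fun y => ?_
        rw [norm_mul, Complex.norm_exp]
        refine mul_le_of_le_one_left (norm_nonneg _) (Real.exp_le_one_iff.2 ?_)
        have : -(π : ℂ) ^ 2 * ‖x - y‖ ^ 2 / ((ε : ℂ) + b) =
            ((-(π ^ 2 * ‖x - y‖ ^ 2) : ℝ) : ℂ) * ((ε : ℂ) + b)⁻¹ := by
          push_cast; ring
        rw [this, Complex.re_ofReal_mul, Complex.inv_re]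
        exact mul_nonpos_of_nonpos_of_nonneg (by simp; positivity)
          (div_nonneg hε.le (Complex.normSq_nonneg _))
      · refine ae_of_all _ fun y => Tendsto.mul_const _ ?_
        exact (Complex.continuous_exp.tendsto _).comp (tendsto_const_nhds.div hβ hb0)
  have hr : Tendsto (fun ε : ℝ => ∫ v, Complex.exp (-((ε : ℂ) + b) * ‖v‖ ^ 2 +
      2 * π * Complex.I * ⟪x, v⟫) * 𝓕 (⇑g) v) (𝓝[>] 0)
      (𝓝 (∫ v, Complex.exp (-b * ‖v‖ ^ 2 + 2 * π * Complex.I * ⟪x, v⟫) * 𝓕 (⇑g) v)) := by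
    have hg : 𝓕 (⇑g) = ⇑(𝓕 g : SchwartzMap E ℂ) := rfl
    rw [hg]
    refine tendsto_integral_filter_of_dominated_convergence
      (fun y => ‖(𝓕 g : SchwartzMap E ℂ) y‖) ?_ ?_ (𝓕 g : SchwartzMap E ℂ).integrable.norm ?_
    · refine Eventually.of_forall fun ε => Continuous.aestronglyMeasurable ?_
      have := (𝓕 g : SchwartzMap E ℂ).continuous
      fun_prop
    · filter_upwards [hpos] with ε hε
      refine ae_of_all _ fun v => ?_
      rw [norm_mul, Complex.norm_exp]
      refine mul_le_of_le_one_left (norm_nonneg _) (Real.exp_le_one_iff.2 ?_)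
      have h1 : -((ε : ℂ) + b) * ‖v‖ ^ 2 = ((‖v‖ ^ 2 : ℝ) : ℂ) * -((ε : ℂ) + b) := by
        push_cast; ring
      have h2 : 2 * π * Complex.I * ⟪x, v⟫ = ((2 * π * ⟪x, v⟫ : ℝ) : ℂ) * Complex.I := by
        push_cast; ring
      rw [Complex.add_re, h1, h2, Complex.re_ofReal_mul, Complex.re_ofReal_mul, Complex.neg_re,
        Complex.I_re]
      nlinarith [sq_nonneg ‖v‖]
    · refine ae_of_all _ fun v => Tendsto.mul_const _ ?_
      exact (Complex.continuous_exp.tendsto _).comp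
        ((hβ.neg.mul_const _).add tendsto_const_nhds)
  have heq := tendsto_nhds_unique (hl.congr' (hpos.mono fun ε hε =>
    integral_gaussian_mul_eq hε g x)) hr
  have hc : (1 / (2 * π * s * Complex.I) : ℂ) = π / b := by rw [hb]; field_simp
  have hk (y : E) : Complex.I * ((‖x - y‖ ^ 2 / (2 * s) : ℝ) : ℂ) =
      -π ^ 2 * ‖x - y‖ ^ 2 / b := by
    rw [hb]; push_cast; field_simp; simp
  simp only [hc, hk, heq]
  rw [SchwartzMap.fourierInv_coe, Real.fourierInv_eq']
  congr 1 with v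
  rw [phaseMul_apply, quadraticPhase, smul_eq_mul, ← mul_assoc, ← Complex.exp_add,
    real_inner_comm x v]
  congr 2
  rw [hb]; push_cast; ring

end FreePropagator

section QuadraticFourier

variable {E : Type*} [NormedAddCommGroup E] [InnerProductSpace ℝ E]

open scoped FourierTransform

/-- Multiplication of Schwartz functions by the symbol `i (a |y|² - y·ξ)`, for `h = (a, ξ)`. -/
def phaseSymbolMul (h : ℝ × E) : SchwartzMap E ℂ →L[ℂ] SchwartzMap E ℂ :=
  SchwartzMap.smulLeftCLM ℂ (fun y => Complex.I * (h.1 * ‖y‖ ^ 2 - ⟪y, h.2⟫ : ℝ))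

@[simp]
lemma phaseSymbolMul_apply (h : ℝ × E) (g : SchwartzMap E ℂ) (y : E) :
    phaseSymbolMul h g y = Complex.I * (h.1 * ‖y‖ ^ 2 - ⟪y, h.2⟫ : ℝ) * g y := by
  have h1 : Function.HasTemperateGrowth (fun y : E => h.1 * ‖y‖ ^ 2 - ⟪y, h.2⟫) :=
    ((Function.HasTemperateGrowth.const h.1).mul (Function.hasTemperateGrowth_norm_sq E)).sub
      (Function.hasTemperateGrowth_inner_left h.2)
  have h2 : Function.HasTemperateGrowth
      (fun y : E => Complex.I * ((h.1 * ‖y‖ ^ 2 - ⟪y, h.2⟫ : ℝ) : ℂ)) :=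
    (Function.HasTemperateGrowth.const Complex.I).mul
      (Function.Complex.hasTemperateGrowth_ofReal.comp h1)
  exact SchwartzMap.smulLeftCLM_apply_apply h2 g y

/-- The pairing on `ℝ × E` that exhibits `quadraticFourier` as a Fourier integral of a measure
carried by a paraboloid. -/
def paraboloidPairing : (ℝ × E) →L[ℝ] (ℝ × E) →L[ℝ] ℝ :=
  let B : E →L[ℝ] E →L[ℝ] ℝ := innerSL ℝ
  (1 / (2 * π)) • (B.bilinearComp (.snd ℝ ℝ E) (.snd ℝ ℝ E) -
    (ContinuousLinearMap.mul ℝ ℝ).bilinearComp (.fst ℝ ℝ E) (.fst ℝ ℝ E))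

lemma paraboloidPairing_apply (v w : ℝ × E) :
    paraboloidPairing v w = 1 / (2 * π) * (⟪v.2, w.2⟫ - v.1 * w.1) :=
  rfl

variable [FiniteDimensional ℝ E] [MeasurableSpace E] [BorelSpace E]

/-- The oscillatory integral `∫ exp (i (a |y|² - y·ξ)) g(y) dy` as a function of `w = (a, ξ)`. -/
def quadraticFourier (g : SchwartzMap E ℂ) (w : ℝ × E) : ℂ :=
  ∫ y, Complex.exp (Complex.I * (w.1 * ‖y‖ ^ 2 - ⟪y, w.2⟫ : ℝ)) * g y

lemma integrable_cexp_I_mul_mul {θ : E → ℝ} (hθ : Continuous θ) (g : SchwartzMap E ℂ) :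
    Integrable (fun y => Complex.exp (Complex.I * θ y) * g y) := by
  refine g.integrable.bdd_mul (c := 1) (Continuous.aestronglyMeasurable (by fun_prop))
    (ae_of_all _ fun y => ?_)
  rw [mul_comm, Complex.norm_exp_ofReal_mul_I]

lemma quadraticFourier_sum {ι : Type*} (s : Finset ι) (g : ι → SchwartzMap E ℂ) (w : ℝ × E) :
    quadraticFourier (∑ i ∈ s, g i) w = ∑ i ∈ s, quadraticFourier (g i) w := by
  simp only [quadraticFourier]
  rw [← integral_finsetSum _ fun i _ => integrable_cexp_I_mul_mul (by fun_prop) (g i)]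
  simp [Finset.mul_sum]

lemma quadraticFourier_smul (c : ℂ) (g : SchwartzMap E ℂ) (w : ℝ × E) :
    quadraticFourier (c • g) w = c * quadraticFourier g w := by
  simp only [quadraticFourier, ← integral_const_mul]
  congr 1 with y
  rw [smul_apply, smul_eq_mul]
  ring

/-- The image of Lebesgue measure on the paraboloid `{(|y|², y)}`. -/
def paraboloidMeasure (E : Type*) [NormedAddCommGroup E] [InnerProductSpace ℝ E]
    [FiniteDimensional ℝ E] [MeasurableSpace E] [BorelSpace E] : Measure (ℝ × E) :=
  Measure.map (fun y : E => (‖y‖ ^ 2, y)) volume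

lemma quadraticFourier_eq_fourierIntegral (g : SchwartzMap E ℂ) :
    quadraticFourier g = VectorFourier.fourierIntegral 𝐞 (paraboloidMeasure E)
      paraboloidPairing.toLinearMap₁₂ (fun v => g v.2) := by
  ext w
  have hm : AEMeasurable (fun y : E => (‖y‖ ^ 2, y)) volume :=
    (Continuous.measurable (by fun_prop)).aemeasurable
  have hc : Continuous (fun v : ℝ × E => 𝐞 (-paraboloidPairing v w) • g v.2) := by
    have := g.continuous
    have := Real.continuous_fourierChar
    fun_prop
  rw [VectorFourier.fourierIntegral, paraboloidMeasure]
  refine Eq.trans ?_ (integral_map hm hc.aestronglyMeasurable).symm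
  rw [quadraticFourier]
  congr 1 with y
  rw [Circle.smul_def, Real.fourierChar_apply, paraboloidPairing_apply, smul_eq_mul]
  congr 2
  push_cast
  field_simp
  ring

lemma integrable_paraboloidMeasure (g : SchwartzMap E ℂ) (n : ℕ) :
    Integrable (fun v : ℝ × E => ‖v‖ ^ n * ‖g v.2‖) (paraboloidMeasure E) := by
  have hm : AEMeasurable (fun y : E => (‖y‖ ^ 2, y)) volume :=
    (Continuous.measurable (by fun_prop)).aemeasurable
  have hc : Continuous (fun v : ℝ × E => ‖v‖ ^ n * ‖g v.2‖) := by
    have := g.continuous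
    fun_prop
  rw [paraboloidMeasure, integrable_map_measure hc.aestronglyMeasurable hm]
  have hp : Function.HasTemperateGrowth (fun y : E => (1 + ‖y‖ ^ 2) ^ n) :=
    ((Function.HasTemperateGrowth.const 1).add (Function.hasTemperateGrowth_norm_sq E)).pow n
  refine (SchwartzMap.smulLeftCLM ℂ (fun y : E => (1 + ‖y‖ ^ 2) ^ n) g).integrable.mono
    (hc.comp (by fun_prop)).aestronglyMeasurable (ae_of_all _ fun y => ?_)
  rw [SchwartzMap.smulLeftCLM_apply_apply hp, norm_smul]
  simp only [Function.comp_apply, norm_mul, norm_pow, norm_norm]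
  gcongr
  rw [Prod.norm_mk, Real.norm_of_nonneg (by positivity), Real.norm_of_nonneg (by positivity)]
  exact max_le (by linarith) (by nlinarith [sq_nonneg (‖y‖ - 1)])

lemma contDiff_quadraticFourier (g : SchwartzMap E ℂ) :
    ContDiff ℝ (⊤ : ℕ∞) (quadraticFourier g) := by
  rw [quadraticFourier_eq_fourierIntegral]
  exact VectorFourier.contDiff_fourierIntegral _ fun n _ => integrable_paraboloidMeasure g n

lemma differentiable_quadraticFourier (g : SchwartzMap E ℂ) :
    Differentiable ℝ (quadraticFourier g) :=
  (contDiff_quadraticFourier g).differentiable (by simp)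

lemma fderiv_quadraticFourier (g : SchwartzMap E ℂ) (w h : ℝ × E) :
    fderiv ℝ (quadraticFourier g) w h = quadraticFourier (phaseSymbolMul h g) w := by
  have hm : AEStronglyMeasurable (fun v : ℝ × E => g v.2) (paraboloidMeasure E) :=
    (g.continuous.comp continuous_snd).aestronglyMeasurable
  have h0 : Integrable (fun v : ℝ × E => g v.2) (paraboloidMeasure E) := by
    rw [← integrable_norm_iff hm]
    simpa using integrable_paraboloidMeasure g 0
  have h1 : Integrable (fun v : ℝ × E => ‖v‖ * ‖g v.2‖) (paraboloidMeasure E) := by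
    simpa using integrable_paraboloidMeasure g 1
  obtain ⟨C, hC⟩ : ∃ C, ∀ v, ‖VectorFourier.fourierSMulRight paraboloidPairing
      (fun v : ℝ × E => g v.2) v‖ ≤ C * (‖v‖ * ‖g v.2‖) :=
    ⟨_, fun v => (VectorFourier.norm_fourierSMulRight_le _ _ v).trans_eq (mul_assoc _ _ _)⟩
  have hi : Integrable (VectorFourier.fourierSMulRight paraboloidPairing
      (fun v : ℝ × E => g v.2)) (paraboloidMeasure E) :=
    (h1.const_mul C).mono' hm.fourierSMulRight (ae_of_all _ hC)
  have hmap : AEMeasurable (fun y : E => (‖y‖ ^ 2, y)) volume :=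
    (Continuous.measurable (by fun_prop)).aemeasurable
  have hpar : ∀ᵐ v ∂(paraboloidMeasure E), v.1 = ‖v.2‖ ^ 2 := by
    rw [paraboloidMeasure, ae_map_iff hmap (measurableSet_eq_fun measurable_fst
      (measurable_snd.norm.pow_const 2))]
    exact ae_of_all _ fun y => rfl
  rw [quadraticFourier_eq_fourierIntegral, quadraticFourier_eq_fourierIntegral,
    VectorFourier.fderiv_fourierIntegral _ h0 h1,
    Real.fourierIntegral_continuousLinearMap_apply' hi]
  refine congrFun (VectorFourier.fourierIntegral_congr_ae _ _ _ ?_) w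
  filter_upwards [hpar] with v hv
  rw [VectorFourier.fourierSMulRight_apply, phaseSymbolMul_apply, paraboloidPairing_apply,
    Complex.real_smul, smul_eq_mul, hv]
  push_cast
  field_simp
  ring

end QuadraticFourier

section Mehler

variable {d : ℕ}

lemma fderiv_quadraticFourier_slice (g : SchwartzMap (EuclideanSpace ℝ (Fin d)) ℂ) (a b : ℝ)
    (x e : EuclideanSpace ℝ (Fin d)) :
    fderiv ℝ (fun y => quadraticFourier g (a, b • y)) x e =
      b * quadraticFourier (phaseSymbolMul (0, e) g) (a, b • x) := by
  have h := HasFDerivAt.comp (f := fun y => (a, b • y)) x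
    (differentiable_quadraticFourier g (a, b • x)).hasFDerivAt
    ((hasFDerivAt_const a x).prodMk ((hasFDerivAt_id x).const_smul b))
  have hv : ((0 : ℝ), b • e) = b • ((0 : ℝ), e) := by simp
  rw [← Function.comp_def (quadraticFourier g), h.fderiv, ← fderiv_quadraticFourier]
  simp [hv, -Prod.smul_mk]

lemma differentiable_quadraticFourier_slice (g : SchwartzMap (EuclideanSpace ℝ (Fin d)) ℂ)
    (a b : ℝ) : Differentiable ℝ (fun y => quadraticFourier g (a, b • y)) :=
  (differentiable_quadraticFourier g).comp (by fun_prop)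

lemma sum_inner_mul_quadraticFourier (g : SchwartzMap (EuclideanSpace ℝ (Fin d)) ℂ)
    (x : EuclideanSpace ℝ (Fin d)) (w : ℝ × EuclideanSpace ℝ (Fin d)) :
    ∑ i, (⟪x, EuclideanSpace.single i 1⟫ : ℂ) *
        quadraticFourier (phaseSymbolMul (0, EuclideanSpace.single i 1) g) w =
      quadraticFourier (phaseSymbolMul (0, x) g) w := by
  simp_rw [← quadraticFourier_smul, ← quadraticFourier_sum]
  congr 1
  ext y
  simp [PiLp.inner_apply, Finset.sum_mul, Finset.mul_sum]
  exact Finset.sum_congr rfl fun i _ => by ring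

lemma sum_quadraticFourier_phaseSymbolMul (g : SchwartzMap (EuclideanSpace ℝ (Fin d)) ℂ)
    (w : ℝ × EuclideanSpace ℝ (Fin d)) :
    ∑ i, quadraticFourier (phaseSymbolMul (0, EuclideanSpace.single i 1)
        (phaseSymbolMul (0, EuclideanSpace.single i 1) g)) w =
      Complex.I * quadraticFourier (phaseSymbolMul (1, 0) g) w := by
  rw [← quadraticFourier_smul, ← quadraticFourier_sum]
  congr 1
  ext y
  simp [EuclideanSpace.inner_single_right, EuclideanSpace.norm_sq_eq, Finset.sum_mul,
    Finset.mul_sum]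
  exact Finset.sum_congr rfl fun i _ => by ring

lemma fderiv_fderiv_quadraticPhase_mul (φ : SchwartzMap (EuclideanSpace ℝ (Fin d)) ℂ) (a b : ℝ)
    (x e : EuclideanSpace ℝ (Fin d)) :
    fderiv ℝ (fun y => fderiv ℝ
        (fun z => quadraticPhase a z * quadraticFourier φ (a, b • z)) y e) x e =
      quadraticPhase a x *
        (2 * Complex.I * a * (⟪e, e⟫ * quadraticFourier φ (a, b • x)) -
          4 * a ^ 2 * (⟪x, e⟫ ^ 2 * quadraticFourier φ (a, b • x)) +
          4 * Complex.I * a * b *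
            (⟪x, e⟫ * quadraticFourier (phaseSymbolMul (0, e) φ) (a, b • x)) +
          b ^ 2 * quadraticFourier (phaseSymbolMul (0, e) (phaseSymbolMul (0, e) φ))
            (a, b • x)) := by
  have hH := differentiable_quadraticFourier_slice φ a b
  have hD := differentiable_quadraticFourier_slice (phaseSymbolMul (0, e) φ) a b
  have hinner : HasFDerivAt (fun y : EuclideanSpace ℝ (Fin d) =>
      2 * Complex.I * a * ((⟪y, e⟫ : ℝ) : ℂ))
      ((2 * Complex.I * a) • Complex.ofRealCLM.comp (innerSL ℝ e)) x := by
    have := ((Complex.ofRealCLM.comp (innerSL ℝ e)).hasFDerivAt (x := x)).const_mul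
      (2 * Complex.I * a)
    simpa [real_inner_comm] using this
  have hG : HasFDerivAt (fun y => 2 * Complex.I * a * ⟪y, e⟫ * quadraticFourier φ (a, b • y) +
      b * quadraticFourier (phaseSymbolMul (0, e) φ) (a, b • y)) _ x :=
    (hinner.mul (hH x).hasFDerivAt).add ((hD x).hasFDerivAt.const_mul (b : ℂ))
  have hfun : (fun y => fderiv ℝ
      (fun z => quadraticPhase a z * quadraticFourier φ (a, b • z)) y e) =
      fun y => quadraticPhase a y * (2 * Complex.I * a * ⟪y, e⟫ * quadraticFourier φ (a, b • y) +
        b * quadraticFourier (phaseSymbolMul (0, e) φ) (a, b • y)) := by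
    ext y
    rw [fderiv_quadraticPhase_mul a (hH y), fderiv_quadraticFourier_slice]
  rw [hfun, fderiv_quadraticPhase_mul a hG.differentiableAt, hG.fderiv]
  simp only [add_apply, smul_apply, smul_eq_mul,
    ContinuousLinearMap.comp_apply, fderiv_quadraticFourier_slice, innerSL_apply_apply,
    Complex.ofRealCLM_apply]
  linear_combination (4 * a ^ 2 * ⟪x, e⟫ ^ 2 * quadraticFourier φ (a, b • x) *
    quadraticPhase a x) * Complex.I_sq

lemma euclideanLaplacian_quadraticPhase_mul (φ : SchwartzMap (EuclideanSpace ℝ (Fin d)) ℂ)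
    (a b : ℝ) (x : EuclideanSpace ℝ (Fin d)) :
    euclideanLaplacian (fun z => quadraticPhase a z * quadraticFourier φ (a, b • z)) x =
      quadraticPhase a x *
        ((2 * Complex.I * a * d - 4 * a ^ 2 * ‖x‖ ^ 2) * quadraticFourier φ (a, b • x) +
          4 * Complex.I * a * b * quadraticFourier (phaseSymbolMul (0, x) φ) (a, b • x) +
          b ^ 2 * (Complex.I * quadraticFourier (phaseSymbolMul (1, 0) φ) (a, b • x))) := by
  have hx : ∑ i, ((⟪x, EuclideanSpace.single i 1⟫ : ℝ) : ℂ) ^ 2 = ((‖x‖ : ℝ) : ℂ) ^ 2 := by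
    rw [← Complex.ofReal_pow, EuclideanSpace.norm_sq_eq]
    simp [EuclideanSpace.inner_single_right]
  have he : ∑ i : Fin d, ((⟪EuclideanSpace.single i (1 : ℝ),
      EuclideanSpace.single i (1 : ℝ)⟫ : ℝ) : ℂ) = d := by
    simp
  simp only [euclideanLaplacian, fderiv_fderiv_quadraticPhase_mul, ← Finset.mul_sum,
    Finset.sum_add_distrib, Finset.sum_sub_distrib, ← Finset.sum_mul, hx, he,
    sum_inner_mul_quadraticFourier, sum_quadraticFourier_phaseSymbolMul]
  ring

end Mehler

section MehlerTime

variable {d : ℕ}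

lemma mehler_integral_eq (φ : SchwartzMap (EuclideanSpace ℝ (Fin d)) ℂ) (s c : ℝ) (hs : s ≠ 0)
    (x : EuclideanSpace ℝ (Fin d)) :
    ∫ y, Complex.exp (Complex.I *
        ((((‖x‖ ^ 2 + ‖y‖ ^ 2) * c - 2 * ⟪x, y⟫) / (2 * s) : ℝ) : ℂ)) * φ y =
      quadraticPhase (c / (2 * s)) x * quadraticFourier φ (c / (2 * s), (1 / s) • x) := by
  rw [quadraticFourier, quadraticPhase, ← integral_const_mul]
  congr 1 with y
  rw [← mul_assoc, ← Complex.exp_add, ← mul_add, ← Complex.ofReal_add, inner_smul_right,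
    real_inner_comm]
  congr 4
  field_simp
  ring

lemma hasDerivAt_quadraticFourier_comp (φ : SchwartzMap (EuclideanSpace ℝ (Fin d)) ℂ)
    {a b : ℝ → ℝ} {a' b' t : ℝ} (ha : HasDerivAt a a' t) (hb : HasDerivAt b b' t)
    (x : EuclideanSpace ℝ (Fin d)) :
    HasDerivAt (fun τ => quadraticFourier φ (a τ, b τ • x))
      (a' * quadraticFourier (phaseSymbolMul (1, 0) φ) (a t, b t • x) +
        b' * quadraticFourier (phaseSymbolMul (0, x) φ) (a t, b t • x)) t := by
  have h := HasFDerivAt.comp_hasDerivAt (f := fun τ => (a τ, b τ • x)) t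
    (differentiable_quadraticFourier φ (a t, b t • x)).hasFDerivAt
    (ha.prodMk (hb.smul_const x))
  have hv : (a', b' • x) = a' • ((1 : ℝ), (0 : EuclideanSpace ℝ (Fin d))) +
      b' • ((0 : ℝ), x) := by simp
  refine h.congr_deriv ?_
  rw [hv, map_add, map_smul, map_smul, fderiv_quadraticFourier, fderiv_quadraticFourier]
  simp

lemma hasDerivAt_quadraticPhase_comp {E : Type*} [NormedAddCommGroup E] {a : ℝ → ℝ} {a' t : ℝ}
    (ha : HasDerivAt a a' t) (x : E) :
    HasDerivAt (fun τ => quadraticPhase (a τ) x)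
      (Complex.I * (a' * ‖x‖ ^ 2) * quadraticPhase (a t) x) t := by
  have h := (hasDerivAt_cexp_I_mul (a t * ‖x‖ ^ 2)).scomp t (ha.mul_const (‖x‖ ^ 2))
  refine h.congr_deriv ?_
  simp [quadraticPhase]
  ring

lemma hasDerivAt_mehler_amplitude {t : ℝ} (ht : 0 < Real.sin t) (p : ℝ) :
    HasDerivAt (fun τ => (((2 * π * Real.sin τ) ^ p : ℝ) : ℂ))
      ((p * (Real.cos t / Real.sin t) : ℝ) * ((2 * π * Real.sin t) ^ p : ℝ)) t := by
  have hpos : 0 < 2 * π * Real.sin t := by positivity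
  have h := (((Real.hasDerivAt_sin t).const_mul (2 * π)).rpow_const (p := p)
    (Or.inl hpos.ne')).ofReal_comp
  refine h.congr_deriv ?_
  rw [Real.rpow_sub_one hpos.ne', ← Complex.ofReal_mul]
  congr 1
  field_simp

lemma euclideanLaplacian_const_mul (k : ℂ) (f : EuclideanSpace ℝ (Fin d) → ℂ)
    (x : EuclideanSpace ℝ (Fin d)) :
    euclideanLaplacian (fun y => k * f y) x = k * euclideanLaplacian f x := by
  have h (g : EuclideanSpace ℝ (Fin d) → ℂ) (y : EuclideanSpace ℝ (Fin d)) :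
      fderiv ℝ (fun z => k * g z) y = k • fderiv ℝ g y :=
    congrFun (fderiv_const_smul_field k (f := g)) y
  simp only [euclideanLaplacian, h, smul_apply, smul_eq_mul, Finset.mul_sum]

lemma mehler_schrodinger (φ : SchwartzMap (EuclideanSpace ℝ (Fin d)) ℂ) (κ : ℂ) {t : ℝ}
    (ht : 0 < Real.sin t) (x : EuclideanSpace ℝ (Fin d)) :
    let ψ := fun (τ : ℝ) (x : EuclideanSpace ℝ (Fin d)) =>
      κ * (((2 * π * Real.sin τ) ^ (-(d : ℝ) / 2) : ℝ) : ℂ) *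
        (quadraticPhase (Real.cos τ / (2 * Real.sin τ)) x *
          quadraticFourier φ (Real.cos τ / (2 * Real.sin τ), (1 / Real.sin τ) • x))
    Complex.I * deriv (fun τ => ψ τ x) t =
      -(1 / 2 : ℂ) * euclideanLaplacian (ψ t) x +
        (1 / 2 : ℂ) * ((‖x‖ ^ 2 : ℝ) : ℂ) * ψ t x := by
  intro ψ
  have ha : HasDerivAt (fun τ => Real.cos τ / (2 * Real.sin τ)) (-1 / (2 * Real.sin t ^ 2)) t := by
    refine ((Real.hasDerivAt_cos t).div ((Real.hasDerivAt_sin t).const_mul 2)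
      (by positivity)).congr_deriv ?_
    field_simp
    linear_combination -Real.sin_sq_add_cos_sq t
  have hb : HasDerivAt (fun τ => 1 / Real.sin τ) (-Real.cos t / Real.sin t ^ 2) t := by
    simpa only [one_div] using (Real.hasDerivAt_sin t).fun_inv ht.ne'
  have hψ : HasDerivAt (fun τ => ψ τ x) _ t :=
    ((hasDerivAt_mehler_amplitude ht (-(d : ℝ) / 2)).const_mul κ).mul
      ((hasDerivAt_quadraticPhase_comp ha x).mul (hasDerivAt_quadraticFourier_comp φ ha hb x))
  have hlap : euclideanLaplacian (ψ t) x = κ * (((2 * π * Real.sin t) ^ (-(d : ℝ) / 2) : ℝ) : ℂ) *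
      euclideanLaplacian (fun x => quadraticPhase (Real.cos t / (2 * Real.sin t)) x *
          quadraticFourier φ (Real.cos t / (2 * Real.sin t), (1 / Real.sin t) • x)) x := by
    exact euclideanLaplacian_const_mul _ _ _
  rw [hψ.deriv, hlap, euclideanLaplacian_quadraticPhase_mul]
  simp only [ψ]
  have hsc := Real.sin_sq_add_cos_sq t
  clear hψ hlap ha hb ψ
  generalize quadraticFourier (phaseSymbolMul (1, 0) φ) _ = F1
  generalize quadraticFourier (phaseSymbolMul (0, x) φ) _ = F2
  generalize quadraticFourier φ _ = F0
  generalize quadraticPhase _ x = P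
  generalize (2 * π * Real.sin t) ^ (-(d : ℝ) / 2) = K
  generalize Real.sin t = s at *
  generalize Real.cos t = c at *
  have hs : (s : ℂ) ≠ 0 := by exact_mod_cast ht.ne'
  have hsc_cast : (s : ℂ) ^ 2 + (c : ℂ) ^ 2 = 1 := by exact_mod_cast hsc
  push_cast
  field_simp
  linear_combination (-4 * κ * K * P * ‖x‖ ^ 2 * F0) * Complex.I_sq +
    (-4 * κ * K * P * ‖x‖ ^ 2 * F0) * hsc_cast

end MehlerTime

section MehlerInitial

variable {d : ℕ}

open scoped FourierTransform

lemma contDiffOn_mehler (φ : SchwartzMap (EuclideanSpace ℝ (Fin d)) ℂ) (κ : ℂ) (p : ℝ) :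
    ContDiffOn ℝ (⊤ : ℕ∞) (fun q : ℝ × EuclideanSpace ℝ (Fin d) =>
      κ * (((2 * π * Real.sin q.1) ^ p : ℝ) : ℂ) *
        (quadraticPhase (Real.cos q.1 / (2 * Real.sin q.1)) q.2 *
          quadraticFourier φ (Real.cos q.1 / (2 * Real.sin q.1), (1 / Real.sin q.1) • q.2)))
      (Ioo (0 : ℝ) π ×ˢ univ) := by
  have hs {q : ℝ × EuclideanSpace ℝ (Fin d)} (hq : q ∈ Ioo (0 : ℝ) π ×ˢ univ) :
      0 < Real.sin q.1 :=
    Real.sin_pos_of_mem_Ioo hq.1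
  have hsin : ContDiffOn ℝ (⊤ : ℕ∞)
      (fun q : ℝ × EuclideanSpace ℝ (Fin d) => Real.sin q.1) (Ioo (0 : ℝ) π ×ˢ univ) :=
    (Real.contDiff_sin.comp contDiff_fst).contDiffOn
  have hcos : ContDiffOn ℝ (⊤ : ℕ∞)
      (fun q : ℝ × EuclideanSpace ℝ (Fin d) => Real.cos q.1) (Ioo (0 : ℝ) π ×ˢ univ) :=
    (Real.contDiff_cos.comp contDiff_fst).contDiffOn
  have ha : ContDiffOn ℝ (⊤ : ℕ∞)
      (fun q : ℝ × EuclideanSpace ℝ (Fin d) => Real.cos q.1 / (2 * Real.sin q.1))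
      (Ioo (0 : ℝ) π ×ˢ univ) :=
    hcos.div (contDiffOn_const.mul hsin) fun q hq => by have := hs hq; positivity
  have hb : ContDiffOn ℝ (⊤ : ℕ∞)
      (fun q : ℝ × EuclideanSpace ℝ (Fin d) => 1 / Real.sin q.1) (Ioo (0 : ℝ) π ×ˢ univ) :=
    contDiffOn_const.div hsin fun q hq => (hs hq).ne'
  have hK : ContDiffOn ℝ (⊤ : ℕ∞)
      (fun q : ℝ × EuclideanSpace ℝ (Fin d) => (2 * π * Real.sin q.1) ^ p)
      (Ioo (0 : ℝ) π ×ˢ univ) :=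
    (contDiffOn_const.mul hsin).rpow_const_of_ne fun q hq => by have := hs hq; positivity
  have hP : ContDiffOn ℝ (⊤ : ℕ∞) (fun q : ℝ × EuclideanSpace ℝ (Fin d) =>
      quadraticPhase (Real.cos q.1 / (2 * Real.sin q.1)) q.2) (Ioo (0 : ℝ) π ×ˢ univ) :=
    (contDiffOn_const.mul (Complex.ofRealCLM.contDiff.comp_contDiffOn
      (ha.mul (contDiff_snd.norm_sq ℝ).contDiffOn))).cexp
  have hF : ContDiffOn ℝ (⊤ : ℕ∞) (fun q : ℝ × EuclideanSpace ℝ (Fin d) =>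
      quadraticFourier φ (Real.cos q.1 / (2 * Real.sin q.1), (1 / Real.sin q.1) • q.2))
      (Ioo (0 : ℝ) π ×ˢ univ) :=
    (contDiff_quadraticFourier φ).comp_contDiffOn (f := fun q : ℝ × EuclideanSpace ℝ (Fin d) =>
      (Real.cos q.1 / (2 * Real.sin q.1), (1 / Real.sin q.1) • q.2))
      (ha.prodMk (hb.smul contDiff_snd.contDiffOn))
  exact (contDiffOn_const.mul (Complex.ofRealCLM.contDiff.comp_contDiffOn hK)).mul (hP.mul hF)

lemma mehler_constant_eq {s : ℝ} (hs : 0 < s) (d : ℕ) :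
    (1 / (2 * π * s * Complex.I)) ^ (d / 2 : ℂ) =
      Complex.exp (-(((π * d / 4 : ℝ) : ℂ) * Complex.I)) *
        (((2 * π * s) ^ (-(d : ℝ) / 2) : ℝ) : ℂ) := by
  have hpos : 0 < 2 * π * s := by positivity
  have h1 : (1 / (2 * π * s * Complex.I) : ℂ) = ((2 * π * s)⁻¹ : ℝ) * -Complex.I := by
    push_cast; rw [one_div, mul_inv, Complex.inv_I]
  have h2 : (-Complex.I) ^ (d / 2 : ℂ) = Complex.exp (-(((π * d / 4 : ℝ) : ℂ) * Complex.I)) := by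
    rw [Complex.cpow_def_of_ne_zero (by simp), Complex.log_neg_I]
    congr 1
    push_cast
    ring
  have h3 : ((2 * π * s)⁻¹ : ℝ) ^ ((d : ℝ) / 2) = (2 * π * s) ^ (-(d : ℝ) / 2) := by
    rw [Real.inv_rpow hpos.le, ← Real.rpow_neg hpos.le, neg_div]
  have hr : 0 < (2 * π * s)⁻¹ := inv_pos.2 hpos
  rw [h1, ← h2, ← h3, Complex.cpow_def_of_ne_zero
    (mul_ne_zero (Complex.ofReal_ne_zero.2 hr.ne') (by simp)),
    Complex.cpow_def_of_ne_zero (by simp), Complex.log_ofReal_mul hr (by simp),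
    Real.rpow_def_of_pos hr, Complex.ofReal_exp, ← Complex.exp_add]
  congr 1
  push_cast
  ring

lemma mehler_eq_phaseMul (φ : SchwartzMap (EuclideanSpace ℝ (Fin d)) ℂ) {s c : ℝ} (hs : 0 < s)
    (x : EuclideanSpace ℝ (Fin d)) :
    Complex.exp (-(((π * d / 4 : ℝ) : ℂ) * Complex.I)) *
        (((2 * π * s) ^ (-(d : ℝ) / 2) : ℝ) : ℂ) *
        ∫ y, Complex.exp (Complex.I *
          ((((‖x‖ ^ 2 + ‖y‖ ^ 2) * c - 2 * ⟪x, y⟫) / (2 * s) : ℝ) : ℂ)) * φ y =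
      phaseMul (-((1 - c) / (2 * s))) (𝓕⁻ (phaseMul (-(2 * π ^ 2 * s))
        (𝓕 (phaseMul (-((1 - c) / (2 * s))) φ)))) x := by
  rw [phaseMul_apply, ← integral_oscillating_gaussian_mul_eq hs, finrank_euclideanSpace,
    Fintype.card_fin, mehler_constant_eq hs, mul_left_comm]
  congr 1
  rw [← integral_const_mul]
  refine integral_congr_ae (ae_of_all _ fun y => ?_)
  dsimp only
  rw [phaseMul_apply, quadraticPhase, quadraticPhase, ← mul_assoc, ← mul_assoc,
    ← Complex.exp_add, ← Complex.exp_add, ← mul_add, ← mul_add, ← Complex.ofReal_add,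
    ← Complex.ofReal_add, norm_sub_sq_real]
  congr 4
  field_simp
  ring

lemma eLpNorm_mehler_sub_le (φ : SchwartzMap (EuclideanSpace ℝ (Fin d)) ℂ) (a b : ℝ) :
    eLpNorm (⇑(phaseMul a (𝓕⁻ (phaseMul b (𝓕 (phaseMul a φ)))) - φ)) 2 volume ≤
      eLpNorm (⇑(phaseMul a φ - φ)) 2 volume +
        eLpNorm (⇑(phaseMul b (𝓕 φ : SchwartzMap (EuclideanSpace ℝ (Fin d)) ℂ) - 𝓕 φ)) 2 volume +
        eLpNorm (⇑(phaseMul a φ - φ)) 2 volume := by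
  refine (eLpNorm_phaseMul_sub_le a _ φ).trans ?_
  rw [eLpNorm_fourierInv_sub_eq]
  gcongr
  refine (eLpNorm_phaseMul_sub_le b _ _).trans ?_
  have h : (𝓕 (phaseMul a φ) : SchwartzMap (EuclideanSpace ℝ (Fin d)) ℂ) - 𝓕 φ =
      𝓕 (phaseMul a φ - φ) :=
    (map_sub (FourierTransform.fourierCLM ℂ (SchwartzMap (EuclideanSpace ℝ (Fin d)) ℂ)) _ _).symm
  rw [h, eLpNorm_fourier_eq, add_comm]

end MehlerInitial

lemma tendsto_neg_one_sub_cos_div_two_mul_sin :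
    Tendsto (fun t => -((1 - Real.cos t) / (2 * Real.sin t))) (𝓝[>] 0) (𝓝 0) := by
  have h : Tendsto (fun t => -(Real.tan (t / 2) / 2)) (𝓝[>] 0) (𝓝 0) := by
    have hc : ContinuousAt (fun t : ℝ => -(Real.tan (t / 2) / 2)) 0 := by
      have h0 : ContinuousAt Real.tan (0 / 2) := Real.continuousAt_tan.2 (by simp)
      have h1 : ContinuousAt (fun t : ℝ => t / 2) 0 := by fun_prop
      exact ((ContinuousAt.comp (f := fun t : ℝ => t / 2) h0 h1).div_const 2).neg
    simpa [ContinuousAt] using hc.tendsto.mono_left (nhdsWithin_le_nhds (s := Ioi (0 : ℝ)))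
  refine h.congr' ?_
  filter_upwards [Ioo_mem_nhdsGT Real.pi_pos] with t ht
  have hs : 0 < Real.sin (t / 2) :=
    Real.sin_pos_of_mem_Ioo ⟨by linarith [ht.1], by linarith [ht.1, ht.2]⟩
  have hc : 0 < Real.cos (t / 2) :=
    Real.cos_pos_of_mem_Ioo ⟨by linarith [ht.1, Real.pi_pos], by linarith [ht.2]⟩
  have h2 : t = 2 * (t / 2) := by ring
  conv_rhs => rw [h2, Real.sin_two_mul, Real.cos_two_mul, Real.cos_sq']
  rw [Real.tan_eq_sin_div_cos]
  field_simp
  ring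

/-- **Mehler's formula**: for `0 < t < π`, the integral kernel
`e^{-iπd/4}(2π sin t)^{-d/2} exp( i((|x|²+|y|²)cos t - 2x·y)/(2 sin t) )` gives the
propagator of the harmonic oscillator `H = -Δ/2 + |x|²/2`: the resulting `ψ` is smooth
on `(0,π) × ℝ^d`, solves `i∂_t ψ = -Δψ/2 + |x|²ψ/2` there, and `ψ(t,·) → φ` in `L²`
as `t → 0⁺`. -/
theorem mehler_formula_harmonic_oscillator
    {d : ℕ} (hd : 1 ≤ d) (φ : SchwartzMap (EuclideanSpace ℝ (Fin d)) ℂ)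
    (ψ : ℝ → EuclideanSpace ℝ (Fin d) → ℂ)
    (hψ : ∀ t ∈ Ioo (0 : ℝ) π, ∀ x : EuclideanSpace ℝ (Fin d),
      ψ t x = Complex.exp (-(((π * d / 4 : ℝ) : ℂ) * Complex.I)) *
        (((2 * π * Real.sin t) ^ (-(d : ℝ) / 2) : ℝ) : ℂ) *
        ∫ (y : EuclideanSpace ℝ (Fin d)),
          Complex.exp (Complex.I *
            ((((‖x‖ ^ 2 + ‖y‖ ^ 2) * Real.cos t - 2 * ⟪x, y⟫) / (2 * Real.sin t) : ℝ) : ℂ)) *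
            φ y) :
    (∀ t ∈ Ioo (0 : ℝ) π, ∀ x : EuclideanSpace ℝ (Fin d),
      Integrable (fun y : EuclideanSpace ℝ (Fin d) =>
        Complex.exp (Complex.I *
          ((((‖x‖ ^ 2 + ‖y‖ ^ 2) * Real.cos t - 2 * ⟪x, y⟫) / (2 * Real.sin t) : ℝ) : ℂ)) *
          φ y)) ∧
    ContDiffOn ℝ (⊤ : ℕ∞) (fun p : ℝ × EuclideanSpace ℝ (Fin d) => ψ p.1 p.2)
      (Ioo (0 : ℝ) π ×ˢ univ) ∧
    (∀ t ∈ Ioo (0 : ℝ) π, ∀ x : EuclideanSpace ℝ (Fin d),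
      Complex.I * deriv (fun τ => ψ τ x) t =
        -(1 / 2 : ℂ) * euclideanLaplacian (ψ t) x +
          (1 / 2 : ℂ) * ((‖x‖ ^ 2 : ℝ) : ℂ) * ψ t x) ∧
    Tendsto (fun t => eLpNorm (fun x => ψ t x - φ x) 2 volume)
      (𝓝[>] (0 : ℝ)) (𝓝 0) := by
  have hsin {t : ℝ} (ht : t ∈ Ioo (0 : ℝ) π) : 0 < Real.sin t := Real.sin_pos_of_mem_Ioo ht
  set κ : ℂ := Complex.exp (-(((π * d / 4 : ℝ) : ℂ) * Complex.I)) with hκ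
  have hψ' : ∀ t ∈ Ioo (0 : ℝ) π, ∀ x, ψ t x =
      κ * (((2 * π * Real.sin t) ^ (-(d : ℝ) / 2) : ℝ) : ℂ) *
        (quadraticPhase (Real.cos t / (2 * Real.sin t)) x *
          quadraticFourier φ (Real.cos t / (2 * Real.sin t), (1 / Real.sin t) • x)) :=
    fun t ht x => by rw [hψ t ht x, mehler_integral_eq φ _ _ (hsin ht).ne']
  refine ⟨fun t _ x => integrable_cexp_I_mul_mul (by fun_prop) φ, ?_, fun t ht x => ?_, ?_⟩
  · exact (contDiffOn_mehler φ κ _).congr fun q hq => hψ' q.1 hq.1 q.2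
  · have h1 : (fun τ => ψ τ x) =ᶠ[𝓝 t] _ :=
      Filter.eventually_of_mem (Ioo_mem_nhds ht.1 ht.2) fun τ hτ => hψ' τ hτ x
    rw [h1.deriv_eq, funext (hψ' t ht)]
    exact mehler_schrodinger φ κ (hsin ht) x
  · have ha := (tendsto_eLpNorm_phaseMul_sub φ).comp tendsto_neg_one_sub_cos_div_two_mul_sin
    have hb : Tendsto (fun t => -(2 * π ^ 2 * Real.sin t)) (𝓝[>] 0) (𝓝 0) := by
      have hc : Continuous (fun t => -(2 * π ^ 2 * Real.sin t)) := by fun_prop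
      simpa using (hc.tendsto 0).mono_left (nhdsWithin_le_nhds (s := Ioi (0 : ℝ)))
    have hsum :=
      (ha.add ((tendsto_eLpNorm_phaseMul_sub (FourierTransform.fourier φ)).comp hb)).add ha
    rw [add_zero, add_zero] at hsum
    refine tendsto_of_tendsto_of_tendsto_of_le_of_le' tendsto_const_nhds hsum
      (Eventually.of_forall fun _ => zero_le) ?_
    filter_upwards [Ioo_mem_nhdsGT Real.pi_pos] with t ht
    refine (eLpNorm_mehler_sub_le φ _ _).trans' (le_of_eq (congrArg (eLpNorm · 2 volume) ?_))
    ext x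
    rw [hψ t ht x, mehler_eq_phaseMul φ (hsin ht)]
    rfl
end
end
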